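/- arXiv:2004.13574 — 4 statements merged into one kernel-verified Lean document; each statement's English description precedes it below -/
import Mathlib

section
/- Let D be a finite set (of documents), r : D → {0,1} relevance labels, Δ : D → ℝ per-document losses, and p : D → ℝ examination propensities with 0 < p(d) ≤ 1 for all d ∈ D. On a probability space, let (o_d)_{d∈D} be {0,1}-valued random variables with E[o_d] = p(d) for each d, and define clicks c_d = o_d · r(d). Then the expectation of the inverse-propensity-weighted loss equals the relevance-based loss: E[ Σ_{d∈D} c_d · Δ(d) / p(d) ] = Σ_{d∈D with r(d)=1} Δ(d). -/
open MeasureTheory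

/-- Paper's Eq. (8): unbiasedness of the Inverse Propensity Weighting (IPW) loss.
The expectation of the IPW-weighted click loss equals the relevance-based loss. -/
theorem ipw_unbiased {D : Type*} [Fintype D] [DecidableEq D]
    {Ω : Type*} [MeasureSpace Ω] [IsProbabilityMeasure (volume : Measure Ω)]
    (r : D → ℝ) (hr : ∀ d, r d = 0 ∨ r d = 1)
    (Δ : D → ℝ)
    (p : D → ℝ) (hp : ∀ d, 0 < p d ∧ p d ≤ 1)
    (o : D → Ω → ℝ) (ho01 : ∀ d ω, o d ω = 0 ∨ o d ω = 1)
    (hoInt : ∀ d, Integrable (o d))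
    (hEo : ∀ d, (∫ ω, o d ω) = p d) :
    (∫ ω, ∑ d, (o d ω * r d) * Δ d / p d) =
      ∑ d ∈ Finset.univ.filter (fun d => r d = 1), Δ d := by
  rw [integral_finsetSum _ fun d _ => (((hoInt d).mul_const _).mul_const _).div_const _,
    Finset.sum_filter]
  refine Finset.sum_congr rfl fun d _ => ?_
  rw [integral_div, integral_mul_const, integral_mul_const, hEo]
  have hpd := (hp d).1.ne'
  rcases hr d with h | h
  · simp [h]
  · simp [h, hpd]
end

section
/- Let D be a finite set (of documents), o : D → {0,1} fixed examination indicators, Δ : D → ℝ per-document losses, and ρ : D → ℝ relevance probabilities with 0 < ρ(d) ≤ 1 for all d ∈ D. On a probability space, let (r_d)_{d∈D} be {0,1}-valued random variables with E[r_d] = ρ(d) for each d, and define clicks c_d = o(d) · r_d. Then the expectation of the inverse-relevance-weighted loss equals the examination-based loss: E[ Σ_{d∈D} c_d · Δ(d) / ρ(d) ] = Σ_{d∈D with o(d)=1} Δ(d). -/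
open MeasureTheory

/-- Paper's Eq. (12): unbiasedness of the Inverse Relevance Weighting (IRW) loss of the
Dual Learning Algorithm. The expectation of the IRW-weighted click loss equals the
examination-based loss. -/
theorem irw_unbiased {D : Type*} [Fintype D] [DecidableEq D]
    {Ω : Type*} [MeasureSpace Ω] [IsProbabilityMeasure (volume : Measure Ω)]
    (o : D → ℝ) (ho : ∀ d, o d = 0 ∨ o d = 1)
    (Δ : D → ℝ)
    (ρ : D → ℝ) (hρ : ∀ d, 0 < ρ d ∧ ρ d ≤ 1)
    (r : D → Ω → ℝ) (hr01 : ∀ d ω, r d ω = 0 ∨ r d ω = 1)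
    (hrInt : ∀ d, Integrable (r d))
    (hEr : ∀ d, (∫ ω, r d ω) = ρ d) :
    (∫ ω, ∑ d, (o d * r d ω) * Δ d / ρ d) =
      ∑ d ∈ Finset.univ.filter (fun d => o d = 1), Δ d := by
  have hterm : ∀ d ω, (o d * r d ω) * Δ d / ρ d = (o d * Δ d / ρ d) * r d ω :=
    fun d ω => by ring
  simp only [hterm]
  rw [integral_finsetSum _ fun d _ => (hrInt d).const_mul _, Finset.sum_filter]
  refine Finset.sum_congr rfl fun d _ => ?_
  rw [integral_const_mul, hEr, div_mul_cancel₀ _ (hρ d).1.ne']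
  rcases ho d with h | h <;> simp [h]
end

section
/- Let Θ be a set (of ranking-model parameters), D a finite set (of documents), r : D → {0,1} relevance labels, p : D → ℝ examination propensities with 0 < p(d) ≤ 1 for all d, and Δ : Θ × D → ℝ per-document losses. On a probability space, let (o_d)_{d∈D} be {0,1}-valued random variables with E[o_d] = p(d) for each d, and set c_d = o_d · r(d). Define the relevance-based loss L(θ) = Σ_{d with r(d)=1} Δ(θ, d) and the expected inverse-propensity-weighted loss L'(θ) = E[ Σ_{d∈D} c_d · Δ(θ, d)/p(d) ]. Then L'(θ) = L(θ) for every θ ∈ Θ, and consequently every global minimizer of L' is a global minimizer of L. -/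
open MeasureTheory

/-- Combination of the paper's Theorem 4.1 with Eq. (8): the expected
inverse-propensity-weighted click loss `L'` equals the relevance-based loss `L` for every
parameter `θ`, and consequently every global minimizer of `L'` is a global minimizer of
`L`; i.e., IPW is a theoretically principled unbiased learning-to-rank algorithm. -/
theorem ipw_principled_unbiased_ltr {Θ : Type*} {D : Type*} [Fintype D] [DecidableEq D]
    {Ω : Type*} [MeasureSpace Ω] [IsProbabilityMeasure (volume : Measure Ω)]
    (r : D → ℝ) (hr : ∀ d, r d = 0 ∨ r d = 1)
    (p : D → ℝ) (hp : ∀ d, 0 < p d ∧ p d ≤ 1)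
    (Δ : Θ → D → ℝ)
    (o : D → Ω → ℝ) (ho01 : ∀ d ω, o d ω = 0 ∨ o d ω = 1)
    (hoInt : ∀ d, Integrable (o d))
    (hEo : ∀ d, (∫ ω, o d ω) = p d) :
    (∀ θ : Θ, (∫ ω, ∑ d, (o d ω * r d) * Δ θ d / p d)
        = ∑ d ∈ Finset.univ.filter (fun d => r d = 1), Δ θ d) ∧
      ∀ θdag : Θ,
        (∀ θ : Θ, (∫ ω, ∑ d, (o d ω * r d) * Δ θdag d / p d)
          ≤ ∫ ω, ∑ d, (o d ω * r d) * Δ θ d / p d) →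
        ∀ θ : Θ, (∑ d ∈ Finset.univ.filter (fun d => r d = 1), Δ θdag d)
          ≤ ∑ d ∈ Finset.univ.filter (fun d => r d = 1), Δ θ d := by
  have unbiased : ∀ θ : Θ, (∫ ω, ∑ d, (o d ω * r d) * Δ θ d / p d)
      = ∑ d ∈ Finset.univ.filter (fun d => r d = 1), Δ θ d := by
    intro θ
    rw [integral_finsetSum _ fun d _ => (((hoInt d).mul_const _).mul_const _).div_const _,
      Finset.sum_filter]
    refine Finset.sum_congr rfl fun d _ => ?_
    rw [integral_div, integral_mul_const, integral_mul_const, hEo]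
    have hpd : p d ≠ 0 := (hp d).1.ne'
    rcases hr d with h | h
    · simp [h]
    · simp [h, hpd]
  refine ⟨unbiased, fun θdag hmin θ => ?_⟩
  simpa only [unbiased] using hmin θ
end

section
/- Let D be a finite set (of documents), p, ρ : D → ℝ with 0 < p(d) ≤ 1 and 0 < ρ(d) ≤ 1 for all d ∈ D, and Δ, Δ' : D → ℝ. On a probability space let (o_d)_{d∈D} and (r_d)_{d∈D} be {0,1}-valued random variables with E[o_d] = p(d) and E[r_d] = ρ(d), such that o_d is independent of r_d for each d; set c_d = o_d · r_d. Then the two dual identities hold simultaneously: E[ Σ_{d∈D} c_d · Δ(d)/p(d) ] = Σ_{d∈D} ρ(d) · Δ(d), and E[ Σ_{d∈D} c_d · Δ'(d)/ρ(d) ] = Σ_{d∈D} p(d) · Δ'(d). That is, inverse propensity weighting recovers the expected relevance-based loss and inverse relevance weighting recovers the expected examination-based loss. -/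
open MeasureTheory ProbabilityTheory

/-- Paper's Section 4.1.3 (combining Eq. (8) and Eq. (12)): the dual identities underlying
the Dual Learning Algorithm. Under the examination hypothesis `c_d = o_d · r_d` with `o_d`
and `r_d` independent, inverse propensity weighting recovers the expected relevance-based
loss, and inverse relevance weighting recovers the expected examination-based loss. -/
theorem dla_dual_unbiased {D : Type*} [Fintype D]
    {Ω : Type*} [MeasureSpace Ω] [IsProbabilityMeasure (volume : Measure Ω)]
    (p ρ : D → ℝ) (hp : ∀ d, 0 < p d ∧ p d ≤ 1) (hρ : ∀ d, 0 < ρ d ∧ ρ d ≤ 1)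
    (Δ Δ' : D → ℝ)
    (o r : D → Ω → ℝ)
    (ho01 : ∀ d ω, o d ω = 0 ∨ o d ω = 1) (hr01 : ∀ d ω, r d ω = 0 ∨ r d ω = 1)
    (hoInt : ∀ d, Integrable (o d)) (hrInt : ∀ d, Integrable (r d))
    (hEo : ∀ d, (∫ ω, o d ω) = p d) (hEr : ∀ d, (∫ ω, r d ω) = ρ d)
    (hindep : ∀ d, IndepFun (o d) (r d) volume) :
    (∫ ω, ∑ d, (o d ω * r d ω) * Δ d / p d) = (∑ d, ρ d * Δ d) ∧
      (∫ ω, ∑ d, (o d ω * r d ω) * Δ' d / ρ d) = ∑ d, p d * Δ' d := by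
  have h_int : ∀ d, Integrable (fun ω => o d ω * r d ω) := fun d =>
    (hindep d).integrable_mul (hoInt d) (hrInt d)
  have h_mul : ∀ d, ∫ ω, o d ω * r d ω = p d * ρ d := fun d => by
    rw [← hEo, ← hEr]
    exact (hindep d).integral_mul_eq_mul_integral
      (hoInt d).aestronglyMeasurable (hrInt d).aestronglyMeasurable
  have h_sum : ∀ w v : D → ℝ,
      ∫ ω, ∑ d, (o d ω * r d ω) * w d / v d = ∑ d, (p d * ρ d) * w d / v d := fun w v => by
    rw [integral_finsetSum _ fun d _ => ((h_int d).mul_const _).div_const _]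
    simp only [integral_div, integral_mul_const, h_mul]
  constructor
  · rw [h_sum]
    refine Finset.sum_congr rfl fun d _ => ?_
    have := (hp d).1.ne'
    field_simp
  · rw [h_sum]
    refine Finset.sum_congr rfl fun d _ => ?_
    have := (hρ d).1.ne'
    field_simp
end
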